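/- Let x₁, x₂, x₃ ∈ ℝ² be affinely independent points (the vertices of a nondegenerate triangle), and let λ₁, λ₂, λ₃ : ℝ² → ℝ be the associated barycentric coordinate functions (the unique affine functions with λᵢ(xⱼ) = δᵢⱼ). For 1 ≤ i < j ≤ 3 set t_{i,j} = xⱼ − xᵢ and 𝕊_{i,j} = t_{i,j}t_{i,j}ᵀ, and let p_{i,j} : ℝ² → ℝ be arbitrary functions. Define the symmetric-matrix-valued field τ(x) = Σ_{1≤i<j≤3} λᵢ(x)λⱼ(x) p_{i,j}(x) 𝕊_{i,j}. Then for every pair 1 ≤ i < j ≤ 3, every point x on the closed segment from xᵢ to xⱼ, and every vector n ∈ ℝ² with n·t_{i,j} = 0, one has τ(x)·n = 0 (matrix-vector product). -/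

import Mathlib

open Matrix

theorem AffineMap.eq_zero_of_mem_segment {E : Type*} [AddCommGroup E] [Module ℝ E]
    (f : E →ᵃ[ℝ] ℝ) {a b x : E} (ha : f a = 0) (hb : f b = 0) (hx : x ∈ segment ℝ a b) :
    f x = 0 := by
  rw [segment_eq_image_lineMap] at hx
  obtain ⟨t, -, rfl⟩ := hx
  simp [AffineMap.apply_lineMap, ha, hb]

theorem bubble_space_vanishing_normal_component
    (pts : Fin 3 → (Fin 2 → ℝ))
    (hind : AffineIndependent ℝ pts)
    -- barycentric coordinate functions: affine maps with `L i (pts j) = δᵢⱼ`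
    (L : Fin 3 → ((Fin 2 → ℝ) →ᵃ[ℝ] ℝ))
    (hL : ∀ i j : Fin 3, L i (pts j) = if i = j then 1 else 0)
    -- arbitrary coefficient functions
    (p : Fin 3 → Fin 3 → (Fin 2 → ℝ) → ℝ) :
    let τ : (Fin 2 → ℝ) → Matrix (Fin 2) (Fin 2) ℝ := fun x =>
      ∑ i, ∑ j, if i < j then
        (L i x * L j x * p i j x) • vecMulVec (pts j - pts i) (pts j - pts i)
      else 0
    ∀ i j : Fin 3, i < j → ∀ x ∈ segment ℝ (pts i) (pts j),
      ∀ nv : Fin 2 → ℝ, nv ⬝ᵥ (pts j - pts i) = 0 → (τ x).mulVec nv = 0 := by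
  intro τ i j hij x hx nv hn
  have hzero : ∀ k, k ≠ i → k ≠ j → L k x = 0 := fun k hki hkj =>
    (L k).eq_zero_of_mem_segment (by simp [hL, hki]) (by simp [hL, hkj]) hx
  simp only [τ, sum_mulVec]
  refine Finset.sum_eq_zero fun a _ => Finset.sum_eq_zero fun b _ => ?_
  split_ifs with hab
  · by_cases h : a = i ∧ b = j
    · obtain ⟨rfl, rfl⟩ := h
      rw [smul_mulVec, vecMulVec_mulVec, dotProduct_comm, hn]
      simp
    · have hprod : L a x * L b x = 0 := by
        have hk : (a ≠ i ∧ a ≠ j) ∨ (b ≠ i ∧ b ≠ j) := by omega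
        rcases hk with ⟨h₁, h₂⟩ | ⟨h₁, h₂⟩
        · rw [hzero a h₁ h₂, zero_mul]
        · rw [hzero b h₁ h₂, mul_zero]
      rw [hprod, zero_mul, zero_smul, zero_mulVec]
  · exact zero_mulVec nv
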